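/- Let p(x) = xⁿ + a_{n-1}x^{n-1} + … + a₀ be a monic polynomial over ℂ with a double root x₀ (multiplicity exactly 2) and all other roots simple and distinct from x₀, and let δp(x) = b_{n-1}x^{n-1} + … + b₀ be a polynomial of degree < n with δp(x₀) = 0. Then the directional derivative of the discriminant D (viewed as a polynomial function of the coefficients a₀,…,a_{n-1}) in the direction (b₀,…,b_{n-1}), namely δD = Σᵢ (∂D/∂aᵢ)·bᵢ, vanishes, and D itself vanishes at (a₀,…,a_{n-1}). -/

import Mathlib

open Polynomial Finset

/-- A monic polynomial of degree `m` over `ℂ` is a product of `m` linear factors. -/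
lemma exists_eq_prod_X_sub_C_of_monic (m : ℕ) (q : ℂ[X]) (hq : q.Monic)
    (hdeg : q.natDegree = m) : ∃ y : Fin m → ℂ, q = ∏ i, (X - C (y i)) := by
  induction m generalizing q with
  | zero => exact ⟨Fin.elim0, by simpa using hq.natDegree_eq_zero.mp hdeg⟩
  | succ m ih =>
    obtain ⟨z, hz⟩ := IsAlgClosed.exists_root q (by
      rw [degree_eq_natDegree hq.ne_zero, hdeg]; exact_mod_cast Nat.succ_ne_zero m)
    obtain ⟨r, rfl⟩ := dvd_iff_isRoot.mpr hz
    have hr : r.Monic := (monic_X_sub_C z).of_mul_monic_left hq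
    have hrdeg : r.natDegree = m := by
      rw [(monic_X_sub_C z).natDegree_mul hr, natDegree_X_sub_C] at hdeg
      omega
    obtain ⟨y, hy⟩ := ih r hr hrdeg
    exact ⟨Fin.cons z y, by simp [Fin.prod_univ_succ, hy]⟩

lemma monic_X_pow_add_sum (n : ℕ) (a : Fin n → ℂ) :
    (X ^ n + ∑ i : Fin n, C (a i) * X ^ (i : ℕ) : ℂ[X]).Monic :=
  monic_X_pow_add (degree_sum_fin_lt a)

lemma natDegree_X_pow_add_sum (n : ℕ) (a : Fin n → ℂ) :
    (X ^ n + ∑ i : Fin n, C (a i) * X ^ (i : ℕ) : ℂ[X]).natDegree = n :=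
  by
  refine natDegree_eq_of_degree_eq_some ?_
  rw [degree_add_eq_left_of_degree_lt] <;> simp [degree_sum_fin_lt a]

/-- A root of a monic polynomial is bounded by one plus the sum of the norms of the lower
coefficients. -/
lemma norm_le_one_add_sum_of_isRoot (n : ℕ) (a : Fin n → ℂ) (z : ℂ)
    (hz : (X ^ n + ∑ i : Fin n, C (a i) * X ^ (i : ℕ) : ℂ[X]).IsRoot z) :
    ‖z‖ ≤ 1 + ∑ i, ‖a i‖ := by
  have hM : 0 ≤ ∑ i, ‖a i‖ := sum_nonneg fun _ _ => norm_nonneg _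
  by_contra! hlt
  have h1 : 1 ≤ ‖z‖ := by linarith
  rw [IsRoot, eval_add, eval_pow, eval_X, eval_finsetSum] at hz
  simp only [eval_mul, eval_C, eval_pow, eval_X] at hz
  cases n with
  | zero => simp at hz
  | succ m =>
    have key : ‖z‖ ^ (m + 1) ≤ (∑ i, ‖a i‖) * ‖z‖ ^ m := by
      rw [← norm_pow, eq_neg_of_add_eq_zero_left hz, norm_neg, sum_mul]
      refine (norm_sum_le _ _).trans (sum_le_sum fun i _ => ?_)
      rw [norm_mul, norm_pow]
      gcongr
      omega
    rw [pow_succ'] at key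
    have := le_of_mul_le_mul_right key (by positivity)
    linarith

/-- The directional derivative of a multivariate polynomial function along a line. -/
lemma hasDerivAt_eval_line {σ : Type*} [Fintype σ] (D : MvPolynomial σ ℂ) (a b : σ → ℂ) :
    HasDerivAt (fun t : ℂ => MvPolynomial.eval (fun i => a i + t * b i) D)
      (∑ i, MvPolynomial.eval a (MvPolynomial.pderiv i D) * b i) 0 := by
  classical
  induction D using MvPolynomial.induction_on with
  | C c => simpa using hasDerivAt_const (0 : ℂ) c
  | add p q hp hq =>
    simp only [map_add, add_mul, sum_add_distrib]
    exact hp.add hq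
  | mul_X p k hp =>
    have hk : HasDerivAt (fun t : ℂ => a k + t * b k) (b k) 0 := by
      simpa using ((hasDerivAt_id (0 : ℂ)).mul_const (b k)).const_add (a k)
    simp only [map_mul, MvPolynomial.eval_X]
    refine (hp.mul hk).congr_deriv ?_
    simp only [Derivation.leibniz, MvPolynomial.pderiv_X, smul_eq_mul, map_add, map_mul,
      MvPolynomial.eval_X, zero_mul, add_zero, add_mul, sum_add_distrib, sum_mul]
    rw [add_comm]
    refine congrArg₂ (· + ·) ?_ (sum_congr rfl fun i _ => by ring)
    rw [sum_eq_single k]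
    · simp
    · intro i _ hi
      simp [hi.symm]
    · simp

/-- Splitting one root off the discriminant: the discriminant of `(X - z) ∏ (X - yᵢ)`. -/
lemma prod_sq_sub_cons (m : ℕ) (z : ℂ) (y : Fin m → ℂ) :
    (∏ i : Fin (m + 1), ∏ j ∈ univ.filter (fun j => i < j),
        ((Fin.cons z y : Fin (m + 1) → ℂ) i - (Fin.cons z y : Fin (m + 1) → ℂ) j) ^ 2) =
      (∏ j, (z - y j)) ^ 2 *
        ∏ i : Fin m, ∏ j ∈ univ.filter (fun j => i < j), (y i - y j) ^ 2 := by
  simp only [prod_filter, Fin.prod_univ_succ, Fin.cons_zero, Fin.cons_succ, ← prod_pow]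
  simp

/-- If `x₀` is a root of `p` with `p'(x₀) = 0` and `δp(x₀) = 0`, the discriminant of `p + t δp`
is `O(t²)`. -/
lemma exists_norm_eval_line_le (n : ℕ) (D : MvPolynomial (Fin n) ℂ)
    (hD : ∀ (a x : Fin n → ℂ),
      (X ^ n + ∑ i : Fin n, C (a i) * X ^ (i : ℕ) : ℂ[X]) = ∏ i, (X - C (x i)) →
        MvPolynomial.eval a D =
          ∏ i : Fin n, ∏ j ∈ univ.filter (fun j => i < j), (x i - x j) ^ 2)
    (a b : Fin n → ℂ) (x₀ : ℂ)
    (hroot : (X ^ n + ∑ i : Fin n, C (a i) * X ^ (i : ℕ) : ℂ[X]).IsRoot x₀)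
    (hderiv : (derivative (X ^ n + ∑ i : Fin n, C (a i) * X ^ (i : ℕ) : ℂ[X])).IsRoot x₀)
    (hδ : ∑ i : Fin n, b i * x₀ ^ (i : ℕ) = 0) :
    ∃ K : ℝ, ∀ t : ℂ, ‖t‖ ≤ 1 →
      ‖MvPolynomial.eval (fun i => a i + t * b i) D‖ ≤ K * ‖t‖ ^ 2 := by
  cases n with
  | zero => simp at hroot
  | succ m =>
  set p : ℂ[X] := X ^ (m + 1) + ∑ i : Fin (m + 1), C (a i) * X ^ (i : ℕ) with hp
  set d : ℂ[X] := ∑ i : Fin (m + 1), C (b i) * X ^ (i : ℕ) with hd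
  set B : ℝ := 1 + ∑ i, (‖a i‖ + ‖b i‖)
  refine ⟨‖(derivative d).eval x₀‖ ^ 2 *
    ∏ i : Fin m, ∏ j ∈ univ.filter (fun j => i < j), (B + B) ^ 2, fun t ht => ?_⟩
  have hline : (X ^ (m + 1) + ∑ i : Fin (m + 1), C (a i + t * b i) * X ^ (i : ℕ) : ℂ[X])
      = p + C t * d := by
    simp only [hp, hd, map_add, map_mul, add_mul, sum_add_distrib, mul_sum, add_assoc, mul_assoc]
  have hdx : d.eval x₀ = 0 := by simpa [hd, eval_finsetSum] using hδ
  have hPx : (p + C t * d).IsRoot x₀ := by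
    simp [IsRoot, hdx, hroot.eq_zero]
  obtain ⟨q, hq⟩ := dvd_iff_isRoot.mpr hPx
  have hmon := monic_X_pow_add_sum (m + 1) (fun i => a i + t * b i)
  have hdeg := natDegree_X_pow_add_sum (m + 1) (fun i => a i + t * b i)
  rw [hline, hq] at hmon hdeg
  have hqm : q.Monic := (monic_X_sub_C x₀).of_mul_monic_left hmon
  have hqdeg : q.natDegree = m := by
    rw [(monic_X_sub_C x₀).natDegree_mul hqm, natDegree_X_sub_C] at hdeg
    omega
  obtain ⟨y, hy⟩ := exists_eq_prod_X_sub_C_of_monic m q hqm hqdeg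
  have hqx : ∏ j, (x₀ - y j) = t * (derivative d).eval x₀ := by
    have h := congrArg (fun r => (derivative r).eval x₀) hq
    simpa [hderiv.eq_zero, hy, eval_prod] using h.symm
  have hyB (i : Fin m) : ‖y i‖ ≤ B := by
    have hyr : (p + C t * d).IsRoot (y i) := by
      rw [hq, IsRoot, eval_mul, hy, eval_prod, prod_eq_zero (mem_univ i) (by simp), mul_zero]
    rw [← hline] at hyr
    refine (norm_le_one_add_sum_of_isRoot _ _ _ hyr).trans ?_
    refine add_le_add le_rfl (sum_le_sum fun j _ => (norm_add_le _ _).trans ?_)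
    rw [norm_mul]
    have := mul_le_mul_of_nonneg_right ht (norm_nonneg (b j))
    linarith
  have hfact : (X ^ (m + 1) + ∑ i : Fin (m + 1), C (a i + t * b i) * X ^ (i : ℕ) : ℂ[X])
      = ∏ i, (X - C ((Fin.cons x₀ y : Fin (m + 1) → ℂ) i)) := by
    rw [hline, hq, hy, Fin.prod_univ_succ]
    simp
  rw [hD _ _ hfact, prod_sq_sub_cons, hqx, norm_mul, norm_pow, norm_mul, mul_pow,
    mul_comm (‖t‖ ^ 2), mul_right_comm]
  refine mul_le_mul_of_nonneg_right (mul_le_mul_of_nonneg_left ?_ (by positivity)) (by positivity)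
  simp only [norm_prod, norm_pow]
  gcongr with i _ j _
  exact (norm_sub_le _ _).trans (add_le_add (hyB i) (hyB j))

/-- Let `D` be the discriminant of the generic monic degree-`n` polynomial,
as a polynomial function of the coefficients `a 0, …, a (n-1)` (characterized by
`D = ∏_{i<j}(xᵢ-xⱼ)²` on root factorizations).  If the monic polynomial
`p = Xⁿ + ∑ aᵢ Xⁱ` has a double root `x₀` (multiplicity exactly 2), all other
roots simple and distinct from `x₀`, and the first variation
`δp = ∑ bᵢ Xⁱ` vanishes at `x₀`, then `D = 0` and the directional derivative
`δD = ∑ (∂D/∂aᵢ)·bᵢ` vanishes at `(a₀,…,a_{n-1})`. -/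
theorem stmt_9 (n : ℕ) (D : MvPolynomial (Fin n) ℂ)
    (hD : ∀ (a x : Fin n → ℂ),
      (X ^ n + ∑ i : Fin n, C (a i) * X ^ (i : ℕ) : Polynomial ℂ) =
          ∏ i, (X - C (x i)) →
        MvPolynomial.eval a D =
          ∏ i : Fin n, ∏ j ∈ Finset.univ.filter (fun j => i < j), (x i - x j) ^ 2)
    (a b : Fin n → ℂ) (x₀ : ℂ)
    (p : Polynomial ℂ) (hp : p = X ^ n + ∑ i : Fin n, C (a i) * X ^ (i : ℕ))
    (hdouble : p.rootMultiplicity x₀ = 2)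
    (hsimple : ∀ z : ℂ, z ≠ x₀ → p.rootMultiplicity z ≤ 1)
    (hδ : ∑ i : Fin n, b i * x₀ ^ (i : ℕ) = 0) :
    MvPolynomial.eval a D = 0 ∧
      ∑ i : Fin n, MvPolynomial.eval a (MvPolynomial.pderiv i D) * b i = 0 := by
  have hp0 : p ≠ 0 := hp ▸ (monic_X_pow_add_sum n a).ne_zero
  have hmult : 1 < p.rootMultiplicity x₀ := by omega
  obtain ⟨hroot, hderiv⟩ := (one_lt_rootMultiplicity_iff_isRoot hp0).mp hmult
  subst hp
  obtain ⟨K, hK⟩ := exists_norm_eval_line_le n D hD a b x₀ hroot hderiv hδ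
  have hzero : MvPolynomial.eval a D = 0 := by simpa using hK 0 (by simp)
  refine ⟨hzero, (hasDerivAt_eval_line D a b).unique ?_⟩
  refine .of_isLittleO (Asymptotics.IsBigO.trans_isLittleO (g := fun t : ℂ => t ^ 2) ?_ ?_)
  · refine Asymptotics.IsBigO.of_bound K ?_
    filter_upwards [Metric.closedBall_mem_nhds (0 : ℂ) one_pos] with t ht
    simpa [hzero] using hK t (by simpa using ht)
  · simpa using Asymptotics.isLittleO_pow_id (𝕜 := ℂ) one_lt_two
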